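/- arXiv:2403.05737 — 4 statements merged into one kernel-verified Lean document; each statement's English description precedes it below -/
import Mathlib

section
/- There exist constants c₁ > 0 and c₂ > 0 such that the following holds. Let L and d be integers with L, d ≥ 16, and let G be a finite simple graph on n ≥ 1 vertices with average degree at least d such that G is d-degenerate. Then either: (A) G has a nonempty induced subgraph G₀ whose average degree d₀ satisfies d₀ ≥ c₁ · d / (log L)² and whose maximum degree is at most c₂ · d₀ · (log L)²; or (B) there is a partition V(G) = A ⊔ B such that |A| ≥ L·|B| and the number of edges of G with one endpoint in A and the other endpoint in B is at least n·d/8. -/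
open SimpleGraph
open scoped Classical

noncomputable section

/-- Minimum degree of a finite simple graph. -/
def minDeg {V : Type} [Fintype V] (G : SimpleGraph V) : ℕ :=
  G.minDegree

/-- Maximum degree of a finite simple graph. -/
def maxDeg {V : Type} [Fintype V] (G : SimpleGraph V) : ℕ :=
  G.maxDegree

/-- Average degree of a finite simple graph. -/
def avgDeg {V : Type} [Fintype V] (G : SimpleGraph V) : ℝ :=
  (∑ v, (G.degree v : ℝ)) / (Fintype.card V)

/-- `G` is `d`-degenerate: every nonempty induced subgraph has a vertex of degree at most `d`. -/
def Degenerate {V : Type} [Fintype V] (G : SimpleGraph V) (d : ℕ) : Prop :=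
  ∀ s : Set V, s.Nonempty → minDeg (G.induce s) ≤ d

/-- adjacency indicator -/
def adjI {V : Type} (G : SimpleGraph V) (u v : V) : ℝ := if G.Adj u v then 1 else 0

/-- number of ordered adjacent pairs in `S × T` -/
def pairs {V : Type} (G : SimpleGraph V) (S T : Finset V) : ℝ := ∑ u ∈ S, ∑ v ∈ T, adjI G u v

lemma adjI_nonneg {V : Type} (G : SimpleGraph V) (u v : V) : 0 ≤ adjI G u v := by
  unfold adjI; split_ifs <;> norm_num

lemma adjI_symm {V : Type} (G : SimpleGraph V) (u v : V) : adjI G u v = adjI G v u := by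
  unfold adjI; simp [G.adj_comm]

lemma adjI_self {V : Type} (G : SimpleGraph V) (u : V) : adjI G u u = 0 := by
  unfold adjI; simp

lemma adjI_sq {V : Type} (G : SimpleGraph V) (u v : V) : adjI G u v * adjI G u v = adjI G u v := by
  unfold adjI; split_ifs <;> norm_num

lemma pairs_symm {V : Type} (G : SimpleGraph V) (S T : Finset V) : pairs G S T = pairs G T S := by
  unfold pairs
  rw [Finset.sum_comm]
  exact Finset.sum_congr rfl fun u _ => Finset.sum_congr rfl fun v _ => adjI_symm G _ _

lemma pairs_nonneg {V : Type} (G : SimpleGraph V) (S T : Finset V) : 0 ≤ pairs G S T :=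
  Finset.sum_nonneg fun _ _ => Finset.sum_nonneg fun _ _ => adjI_nonneg G _ _

lemma pairs_union_left {V : Type} (G : SimpleGraph V) {S S' : Finset V} (T : Finset V)
    (h : Disjoint S S') : pairs G (S ∪ S') T = pairs G S T + pairs G S' T := by
  unfold pairs; rw [Finset.sum_union h]

lemma pairs_union_right {V : Type} (G : SimpleGraph V) {S S' : Finset V} (T : Finset V)
    (h : Disjoint S S') : pairs G T (S ∪ S') = pairs G T S + pairs G T S' := by
  rw [pairs_symm, pairs_union_left G T h, pairs_symm G S, pairs_symm G S']

lemma pairs_union_self {V : Type} (G : SimpleGraph V) {S T : Finset V}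
    (h : Disjoint S T) :
    pairs G (S ∪ T) (S ∪ T) = pairs G S S + pairs G T T + 2 * pairs G S T := by
  rw [pairs_union_left G _ h, pairs_union_right G _ h, pairs_union_right G _ h, pairs_symm G T S]
  ring

lemma pairs_mono {V : Type} (G : SimpleGraph V) {S S' T T' : Finset V} (h : S ⊆ S') (h' : T ⊆ T') :
    pairs G S T ≤ pairs G S' T' := by
  unfold pairs
  calc _ ≤ ∑ u ∈ S, ∑ v ∈ T', adjI G u v := Finset.sum_le_sum fun u _ =>
        Finset.sum_le_sum_of_subset_of_nonneg h' fun v _ _ => adjI_nonneg G _ _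
    _ ≤ _ := Finset.sum_le_sum_of_subset_of_nonneg h fun u _ _ =>
        Finset.sum_nonneg fun v _ => adjI_nonneg G _ _

lemma degree_eq_sum {V : Type} [Fintype V] (G : SimpleGraph V) (v : V)
    [Fintype (G.neighborSet v)] :
    (G.degree v : ℝ) = ∑ u, adjI G v u := by
  unfold adjI
  rw [Finset.sum_boole, ← G.card_neighborFinset_eq_degree]
  congr 2
  ext u; simp

lemma maxDeg_eq {V : Type} [Fintype V] [Nonempty V] (G : SimpleGraph V) :
    ∃ v, (maxDeg G : ℝ) = ∑ u, adjI G v u := by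
  obtain ⟨v, hv⟩ := G.exists_maximal_degree_vertex
  refine ⟨v, ?_⟩
  rw [← degree_eq_sum, ← hv, maxDeg]

lemma minDeg_eq {V : Type} [Fintype V] [Nonempty V] (G : SimpleGraph V) :
    ∃ v, (minDeg G : ℝ) = ∑ u, adjI G v u := by
  obtain ⟨v, hv⟩ := G.exists_minimal_degree_vertex
  refine ⟨v, ?_⟩
  rw [← degree_eq_sum, ← hv, minDeg]

lemma avgDeg_eq {V : Type} [Fintype V] (G : SimpleGraph V) :
    avgDeg G = (∑ v, ∑ u, adjI G v u) / (Fintype.card V) := by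
  unfold avgDeg
  simp_rw [degree_eq_sum]

lemma sum_induce_eq {V : Type} (G : SimpleGraph V) (s : Finset V) (t : Set V) [Fintype t]
    (h : ∀ v, v ∈ s ↔ v ∈ t) (v : t) :
    ∑ u : t, adjI (G.induce t) v u = ∑ u ∈ s, adjI G v u := by
  have h1 : ∀ u : t, adjI (G.induce t) v u = adjI G v u := by
    intro u; simp [adjI]
  simp_rw [h1]
  exact (Finset.sum_subtype s h (fun u => adjI G v u)).symm

lemma finish {V : Type} (G : SimpleGraph V) (s : Finset V) (t : Set V) [Fintype t]
    (h : ∀ v, v ∈ s ↔ v ∈ t) (hs : s.Nonempty)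
    (δ Δ : ℝ) (h1 : δ * s.card ≤ pairs G s s) (h2 : ∀ v ∈ s, ∑ u ∈ s, adjI G v u ≤ Δ) :
    δ ≤ avgDeg (G.induce t) ∧ (maxDeg (G.induce t) : ℝ) ≤ Δ := by
  constructor
  · rw [avgDeg_eq]
    have hc : (Fintype.card t : ℝ) = s.card := by
      norm_cast
      exact Fintype.card_of_subtype s h
    rw [hc, le_div_iff₀ (by exact_mod_cast hs.card_pos)]
    refine h1.trans (le_of_eq ?_)
    simp_rw [sum_induce_eq G s t h]
    exact Finset.sum_subtype s h (fun v => ∑ u ∈ s, adjI G v u)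
  · have : Nonempty t := by
      obtain ⟨x, hx⟩ := hs
      exact ⟨⟨x, (h x).1 hx⟩⟩
    obtain ⟨v, hv⟩ := maxDeg_eq (G.induce t)
    rw [hv, sum_induce_eq G s t h]
    exact h2 v ((h v).2 v.2)

lemma degen_pairs {V : Type} [Fintype V] (G : SimpleGraph V) (d : ℕ) (hG : Degenerate G d)
    (k : ℕ) : ∀ s : Finset V, s.card = k → pairs G s s ≤ 2 * d * s.card := by
  induction k with
  | zero =>
    intro s hs
    rw [Finset.card_eq_zero] at hs
    subst hs; simp [pairs]
  | succ k ih =>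
    intro s hs
    have hne : s.Nonempty := by rw [← Finset.card_pos]; omega
    obtain ⟨t, ht⟩ : ∃ t : Set V, ∀ v, v ∈ s ↔ v ∈ t := ⟨{v | v ∈ s}, fun _ => Iff.rfl⟩
    have h := hG t (by obtain ⟨x, hx⟩ := hne; exact ⟨x, (ht x).1 hx⟩)
    have : Nonempty t := by
      obtain ⟨x, hx⟩ := hne
      exact ⟨⟨x, (ht x).1 hx⟩⟩
    obtain ⟨v, hv⟩ := minDeg_eq (G.induce t)
    have h' : (minDeg (G.induce t) : ℝ) ≤ d := by exact_mod_cast h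
    rw [hv, sum_induce_eq G s t ht] at h'
    have hvs : (v : V) ∈ s := (ht v).2 v.2
    have hsplit : s = s.erase v ∪ {(v : V)} := by
      rw [Finset.union_comm, ← Finset.insert_eq, Finset.insert_erase hvs]
    have hdis : Disjoint (s.erase (v : V)) {(v : V)} := by simp
    have hcard : (s.erase (v : V)).card = k := by rw [Finset.card_erase_of_mem hvs]; omega
    have h3 := ih _ hcard
    have h4 : pairs G {(v : V)} (s.erase v) ≤ d := by
      refine le_trans (pairs_mono G (Finset.Subset.refl _) (Finset.erase_subset _ s)) ?_
      simpa [pairs] using h'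
    have h5 : pairs G {(v : V)} {(v : V)} = 0 := by simp [pairs, adjI_self]
    have h6 := pairs_union_self G hdis
    rw [← hsplit, pairs_symm G (s.erase _) {_}, h5] at h6
    rw [h6, hs]
    rw [hcard] at h3
    push_cast
    linarith

lemma cut_card {V : Type} [Fintype V] (G : SimpleGraph V) (A : Finset V) :
    pairs G A (Finset.univ \ A) ≤
      ((G.edgeFinset.filter fun e => ∃ a ∈ A, ∃ b ∉ A, e = s(a, b)).card : ℝ) := by
  have h1 : pairs G A (Finset.univ \ A) =
      (((A ×ˢ (Finset.univ \ A)).filter fun p => G.Adj p.1 p.2).card : ℝ) := by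
    unfold pairs adjI
    rw [← Finset.sum_product', Finset.sum_boole]
  rw [h1]
  norm_cast
  apply Finset.card_le_card_of_injOn (fun p => s(p.1, p.2))
  · rintro ⟨a, b⟩ h
    simp at h ⊢
    exact ⟨h.2, a, h.1.1, b, h.1.2, Or.inl ⟨rfl, rfl⟩⟩
  · rintro ⟨a, b⟩ h ⟨a', b'⟩ h' heq
    simp at h h' heq
    rcases heq with ⟨rfl, rfl⟩ | ⟨rfl, rfl⟩
    · rfl
    · exact absurd h.1.1 h'.1.2

lemma coloring {V : Type} (w : V → V → ℝ) (hw : ∀ x y, 0 ≤ w x y) (hs : ∀ x y, w x y = w y x)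
    (m : ℕ) (hm : 0 < m) (X : Finset V) :
    ∃ f : V → Fin m, (m : ℝ) * ∑ x ∈ X, ∑ y ∈ X, (if x ≠ y ∧ f x = f y then w x y else 0) ≤
      ∑ x ∈ X, ∑ y ∈ X, w x y := by
  induction X using Finset.induction_on with
  | empty => exact ⟨fun _ => ⟨0, hm⟩, by simp⟩
  | insert x X hx ih =>
    obtain ⟨f, hf⟩ := ih
    have : Nonempty (Fin m) := ⟨⟨0, hm⟩⟩
    obtain ⟨c, -, hc⟩ : ∃ c ∈ (Finset.univ : Finset (Fin m)),
        (m : ℝ) * ∑ y ∈ X, (if c = f y then w x y else 0) ≤ ∑ y ∈ X, w x y := by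
      apply Finset.exists_le_of_sum_le Finset.univ_nonempty
      rw [← Finset.mul_sum, Finset.sum_comm]
      simp
    refine ⟨Function.update f x c, ?_⟩
    have hne : ∀ y ∈ X, y ≠ x := fun y hy h => hx (h ▸ hy)
    rw [Finset.sum_insert hx, Finset.sum_insert hx, Finset.sum_insert hx, Finset.sum_insert hx]
    have e1 : ∑ y ∈ X, (if x ≠ y ∧ Function.update f x c x = Function.update f x c y then w x y else 0)
        = ∑ y ∈ X, (if c = f y then w x y else 0) := by
      refine Finset.sum_congr rfl fun y hy => ?_
      simp [hne y hy, (hne y hy).symm]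
    have e2 : ∑ z ∈ X, ∑ y ∈ insert x X,
          (if z ≠ y ∧ Function.update f x c z = Function.update f x c y then w z y else 0)
        = ∑ y ∈ X, (if c = f y then w x y else 0) +
          ∑ z ∈ X, ∑ y ∈ X, (if z ≠ y ∧ f z = f y then w z y else 0) := by
      rw [← Finset.sum_add_distrib]
      refine Finset.sum_congr rfl fun z hz => ?_
      rw [Finset.sum_insert hx]
      congr 1
      · simp [hne z hz, hs z x, eq_comm]
      · refine Finset.sum_congr rfl fun y hy => ?_
        simp [hne z hz, hne y hy]
    have e3 : ∑ z ∈ X, ∑ y ∈ insert x X, w z y = ∑ y ∈ X, w x y + ∑ z ∈ X, ∑ y ∈ X, w z y := by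
      rw [← Finset.sum_add_distrib]
      refine Finset.sum_congr rfl fun z hz => ?_
      rw [Finset.sum_insert hx, hs z x]
    rw [e1, e2, e3]
    have := hw x x
    simp only [ne_eq, not_true_eq_false, false_and, if_false]
    linarith

/-- Splitting `X` into `m` classes so that the sum of squared degrees behaves as expected. -/
lemma splitting {V : Type} (G : SimpleGraph V) (X Y : Finset V) (m : ℕ) (hm : 0 < m) :
    ∃ f : V → Fin m,
      (∑ c : Fin m, ∑ y ∈ Y, (∑ x ∈ X.filter (fun x => f x = c), adjI G y x) ^ 2) ≤
        ∑ y ∈ Y, ((∑ x ∈ X, adjI G y x) + (∑ x ∈ X, adjI G y x) ^ 2 / m) := by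
  obtain ⟨f, hf⟩ := coloring (fun x x' => ∑ y ∈ Y, adjI G y x * adjI G y x')
    (fun x x' => Finset.sum_nonneg fun y _ => mul_nonneg (adjI_nonneg _ _ _) (adjI_nonneg _ _ _))
    (fun x x' => Finset.sum_congr rfl fun y _ => mul_comm _ _) m hm X
  refine ⟨f, ?_⟩
  have hm' : (0 : ℝ) < m := by exact_mod_cast hm
  have h1 : ∑ x ∈ X, ∑ x' ∈ X, ∑ y ∈ Y, adjI G y x * adjI G y x' =
      ∑ y ∈ Y, (∑ x ∈ X, adjI G y x) ^ 2 := by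
    rw [Finset.sum_congr rfl fun x _ => Finset.sum_comm, Finset.sum_comm]
    refine Finset.sum_congr rfl fun y _ => ?_
    rw [sq, Finset.sum_mul_sum]
  have h2 : (∑ c : Fin m, ∑ y ∈ Y, (∑ x ∈ X.filter (fun x => f x = c), adjI G y x) ^ 2) =
      ∑ x ∈ X, ∑ x' ∈ X, if f x = f x' then ∑ y ∈ Y, adjI G y x * adjI G y x' else 0 := by
    have : ∀ c : Fin m, ∑ y ∈ Y, (∑ x ∈ X.filter (fun x => f x = c), adjI G y x) ^ 2 =
        ∑ x ∈ X, ∑ x' ∈ X, if f x = c then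
          (if f x' = c then ∑ y ∈ Y, adjI G y x * adjI G y x' else 0) else 0 := by
      intro c
      have : ∀ x ∈ X, ∑ x' ∈ X, (if f x = c then
          (if f x' = c then ∑ y ∈ Y, adjI G y x * adjI G y x' else 0) else 0) =
          if f x = c then ∑ x' ∈ X.filter (fun x => f x = c), ∑ y ∈ Y, adjI G y x * adjI G y x'
            else 0 := by
        intro x _
        split_ifs
        · rw [Finset.sum_filter]
        · simp
      rw [Finset.sum_congr rfl this, ← Finset.sum_filter,
        Finset.sum_congr rfl fun x _ => Finset.sum_comm, Finset.sum_comm]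
      refine Finset.sum_congr rfl fun y _ => ?_
      rw [sq, Finset.sum_mul_sum]
    simp_rw [this]
    rw [Finset.sum_comm]
    refine Finset.sum_congr rfl fun x _ => ?_
    rw [Finset.sum_comm]
    refine Finset.sum_congr rfl fun x' _ => ?_
    simp [eq_comm]
  have h3 : (∑ x ∈ X, ∑ x' ∈ X, if f x = f x' then ∑ y ∈ Y, adjI G y x * adjI G y x' else 0) =
      (∑ x ∈ X, ∑ x' ∈ X, if x ≠ x' ∧ f x = f x' then ∑ y ∈ Y, adjI G y x * adjI G y x' else 0)
      + ∑ y ∈ Y, ∑ x ∈ X, adjI G y x := by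
    rw [Finset.sum_comm (s := Y), ← Finset.sum_add_distrib]
    refine Finset.sum_congr rfl fun x hx => ?_
    have : ∑ y ∈ Y, adjI G y x = ∑ x' ∈ X, if x = x' then ∑ y ∈ Y, adjI G y x else 0 := by
      simp [hx]
    rw [this, ← Finset.sum_add_distrib]
    refine Finset.sum_congr rfl fun x' _ => ?_
    by_cases h : x = x'
    · subst h; simp [adjI_sq]
    · simp [h]
  rw [h2, h3, Finset.sum_add_distrib, ← Finset.sum_div, add_comm]
  gcongr
  rw [le_div_iff₀ hm', mul_comm, ← h1]
  exact hf

lemma row_mono {V : Type} [Fintype V] (G : SimpleGraph V) (s : Finset V) (v : V) :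
    ∑ u ∈ s, adjI G v u ≤ ∑ u, adjI G v u :=
  Finset.sum_le_sum_of_subset_of_nonneg (Finset.subset_univ s) fun _ _ _ => adjI_nonneg G _ _

lemma bucket {V : Type} [Fintype V] [Nonempty V] (G : SimpleGraph V) (d J m : ℕ) (hJ : 1 ≤ J)
    (hm : 0 < m) (hd : 16 ≤ d) (hdeg : ∀ s : Finset V, pairs G s s ≤ 2 * d * s.card)
    (V0 Y0 : Finset V) (hdis : Disjoint V0 Y0)
    (hV0 : ∀ v ∈ V0, ∑ u, adjI G v u ≤ 16 * d)
    (hY0 : ∀ v ∈ Y0, 8 * m * d ≤ ∑ u, adjI G v u ∧ ∑ u, adjI G v u ≤ 16 * m * d)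
    (he : (Fintype.card V : ℝ) * d / (8 * J) ≤ pairs G Y0 V0) :
    ∃ s : Finset V, s.Nonempty ∧ d / (32 * J) * s.card ≤ pairs G s s ∧
      ∀ v ∈ s, ∑ u ∈ s, adjI G v u ≤ 2208 * d * J := by
  obtain ⟨n, hn⟩ : ∃ n : ℝ, n = Fintype.card V := ⟨_, rfl⟩
  have hn0 : 0 < n := by rw [hn]; exact_mod_cast Fintype.card_pos
  have hJ' : (1 : ℝ) ≤ J := by exact_mod_cast hJ
  have hm' : (1 : ℝ) ≤ m := by exact_mod_cast hm
  have hd' : (16 : ℝ) ≤ d := by exact_mod_cast hd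
  have hd0 : (0 : ℝ) < d := by linarith
  have hJ0 : (0 : ℝ) < J := by linarith
  have hm0 : (0 : ℝ) < m := by linarith
  rw [← hn] at he
  have hY0card : (Y0.card : ℝ) * (4 * m) ≤ n := by
    have h1 : (Y0.card : ℝ) * (8 * m * d) ≤ ∑ v ∈ Y0, ∑ u, adjI G v u := by
      rw [← nsmul_eq_mul]
      exact Finset.card_nsmul_le_sum _ _ _ fun v hv => (hY0 v hv).1
    have h2 : ∑ v ∈ Y0, ∑ u, adjI G v u ≤ pairs G Finset.univ Finset.univ :=
      pairs_mono G (Finset.subset_univ _) (Finset.Subset.refl _)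
    have h3 := hdeg Finset.univ
    rw [Finset.card_univ, ← hn] at h3
    have h4 : (Y0.card : ℝ) * (4 * m) * (2 * d) ≤ n * (2 * d) := by linarith
    exact le_of_mul_le_mul_right h4 (by linarith)
  set R := Y0.filter (fun v => ¬ ∑ u ∈ Y0, adjI G v u ≤ 128 * d * J) with hR
  set Y := Y0.filter (fun v => ∑ u ∈ Y0, adjI G v u ≤ 128 * d * J) with hY
  have hRcard : (R.card : ℝ) * (64 * J) ≤ Y0.card := by
    have h1 : (R.card : ℝ) * (128 * d * J) ≤ ∑ v ∈ R, ∑ u ∈ Y0, adjI G v u := by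
      rw [← nsmul_eq_mul]
      refine Finset.card_nsmul_le_sum _ _ _ fun v hv => ?_
      rw [hR, Finset.mem_filter] at hv
      exact (not_le.1 hv.2).le
    have h2 : ∑ v ∈ R, ∑ u ∈ Y0, adjI G v u ≤ pairs G Y0 Y0 :=
      pairs_mono G (Finset.filter_subset _ _) (Finset.Subset.refl _)
    have h3 := hdeg Y0
    have h4 : (R.card : ℝ) * (64 * J) * (2 * d) ≤ Y0.card * (2 * d) := by linarith
    exact le_of_mul_le_mul_right h4 (by linarith)
  have hRp : pairs G R V0 ≤ n * d / (16 * J) := by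
    have h1 : pairs G R V0 ≤ (R.card : ℝ) * (16 * m * d) := by
      rw [← nsmul_eq_mul]
      refine Finset.sum_le_card_nsmul _ _ _ fun v hv => ?_
      exact (row_mono G V0 v).trans (hY0 v (Finset.mem_of_mem_filter v hv)).2
    rw [le_div_iff₀ (by positivity)]
    calc pairs G R V0 * (16 * J) ≤ (R.card : ℝ) * (16 * m * d) * (16 * J) := by gcongr
      _ = (R.card : ℝ) * (64 * J) * (4 * m) * d := by ring
      _ ≤ Y0.card * (4 * m) * d := by gcongr
      _ ≤ n * d := by gcongr
  have hYp : n * d / (16 * J) ≤ pairs G Y V0 := by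
    have h1 : Y ∪ R = Y0 := Finset.filter_union_filter_not_eq _ _
    have h2 : Disjoint Y R := Finset.disjoint_filter_filter_not _ _ _
    have h3 := pairs_union_left G V0 h2
    rw [h1] at h3
    have h4 : n * d / (8 * J) = n * d / (16 * J) + n * d / (16 * J) := by field_simp; norm_num
    linarith
  have hYcard : (Y.card : ℝ) * (4 * m) ≤ n := by
    refine le_trans ?_ hY0card
    gcongr
    exact Finset.filter_subset _ _
  have hYne : 0 < (Y.card : ℝ) := by
    rcases Y.eq_empty_or_nonempty with h | h
    · rw [h] at hYp
      have : 0 < n * d / (16 * J) := by positivity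
      simp [pairs] at hYp
      linarith
    · exact_mod_cast h.card_pos
  obtain ⟨f, hf⟩ := splitting G V0 Y m hm
  set S : Fin m → Finset V := fun c => V0.filter (fun x => f x = c) with hS
  have hsq : (∑ c : Fin m, ∑ y ∈ Y, (∑ x ∈ S c, adjI G y x) ^ 2) ≤ 65 * n * d ^ 2 := by
    refine hf.trans ?_
    have h1 : ∑ y ∈ Y, ((∑ x ∈ V0, adjI G y x) + (∑ x ∈ V0, adjI G y x) ^ 2 / m) ≤
        (Y.card : ℝ) * (m * (257 * d ^ 2)) := by
      rw [← nsmul_eq_mul]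
      refine Finset.sum_le_card_nsmul _ _ _ fun y hy => ?_
      have h2 : ∑ x ∈ V0, adjI G y x ≤ 16 * m * d :=
        (row_mono G V0 y).trans (hY0 y (Finset.mem_of_mem_filter y hy)).2
      have h0 : 0 ≤ ∑ x ∈ V0, adjI G y x := Finset.sum_nonneg fun _ _ => adjI_nonneg G _ _
      have h3 : (∑ x ∈ V0, adjI G y x) ^ 2 / m ≤ 256 * m * d ^ 2 := by
        rw [div_le_iff₀ hm0]
        calc _ ≤ (16 * m * d : ℝ) ^ 2 := by gcongr
          _ = _ := by ring
      have h4 : 16 * (m : ℝ) * d ≤ m * d ^ 2 := by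
        have : (m : ℝ) * d * 16 ≤ m * d * d := by gcongr
        linarith
      linarith
    refine h1.trans ?_
    calc (Y.card : ℝ) * (m * (257 * d ^ 2)) = (Y.card : ℝ) * (4 * m) * (257 / 4 * d ^ 2) := by ring
      _ ≤ n * (257 / 4 * d ^ 2) := by gcongr
      _ ≤ 65 * n * d ^ 2 := by
        have : 0 < n * (d : ℝ) ^ 2 := by positivity
        linarith
  obtain ⟨T, hT⟩ : ∃ T : ℝ, T = 2080 * d * J := ⟨_, rfl⟩
  have hT0 : 0 < T := by rw [hT]; positivity
  have hsumS : ∑ c : Fin m, pairs G Y (S c) = pairs G Y V0 := by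
    unfold pairs
    rw [Finset.sum_comm]
    refine Finset.sum_congr rfl fun y _ => ?_
    exact Finset.sum_fiberwise V0 f (fun x => adjI G y x)
  have hcardS : ∑ c : Fin m, ((S c).card : ℝ) = V0.card := by
    have := Finset.sum_fiberwise V0 f (fun _ => (1 : ℝ))
    simpa using this
  have hm1 : Nonempty (Fin m) := ⟨⟨0, hm⟩⟩
  obtain ⟨c, -, hc⟩ : ∃ c ∈ (Finset.univ : Finset (Fin m)),
      d / (64 * J) * ((S c).card + Y.card : ℝ) ≤
        pairs G Y (S c) - (∑ y ∈ Y, (∑ x ∈ S c, adjI G y x) ^ 2) / T := by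
    apply Finset.exists_le_of_sum_le Finset.univ_nonempty
    rw [← Finset.mul_sum, Finset.sum_add_distrib, hcardS, Finset.sum_sub_distrib, hsumS,
      ← Finset.sum_div]
    have h1 : (∑ c : Fin m, ∑ y ∈ Y, (∑ x ∈ S c, adjI G y x) ^ 2) / T ≤ n * d / (32 * J) := by
      rw [div_le_iff₀ hT0, hT]
      refine hsq.trans (le_of_eq ?_)
      field_simp
      norm_num
    have h2 : (V0.card : ℝ) ≤ n := by rw [hn]; exact_mod_cast Finset.card_le_univ V0
    have h3 : d / (64 * J) * ((V0.card : ℝ) + ∑ c : Fin m, (Y.card : ℝ)) ≤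
        d / (64 * J) * (2 * n) := by
      gcongr
      simp
      linarith
    have h4 : d / (64 * J) * (2 * n) = n * d / (32 * J) := by field_simp; norm_num
    have h5 : n * d / (16 * J) = n * d / (32 * J) + n * d / (32 * J) := by field_simp; norm_num
    linarith
  set Y' := Y.filter (fun y => ∑ x ∈ S c, adjI G y x ≤ T) with hY'
  have hlow : pairs G Y (S c) - (∑ y ∈ Y, (∑ x ∈ S c, adjI G y x) ^ 2) / T ≤ pairs G Y' (S c) := by
    unfold pairs
    rw [Finset.sum_div, ← Finset.sum_sub_distrib, hY',
      Finset.sum_filter (s := Y) (f := fun y => ∑ x ∈ S c, adjI G y x)]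
    refine Finset.sum_le_sum fun y _ => ?_
    split_ifs with h
    · have : 0 ≤ (∑ x ∈ S c, adjI G y x) ^ 2 / T := by positivity
      linarith
    · refine sub_nonpos.2 ?_
      rw [le_div_iff₀ hT0, sq]
      push Not at h
      exact mul_le_mul_of_nonneg_left h.le (Finset.sum_nonneg fun _ _ => adjI_nonneg G _ _)
  have hdis' : Disjoint (S c) Y' := by
    refine Finset.disjoint_of_subset_left (Finset.filter_subset _ _)
      (Finset.disjoint_of_subset_right ?_ hdis)
    exact (Finset.filter_subset _ _).trans (Finset.filter_subset _ _)
  have hY'ne : Y'.Nonempty := by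
    rw [Finset.nonempty_iff_ne_empty]
    intro h
    rw [h] at hlow
    have h1 : pairs G ∅ (S c) = 0 := by simp [pairs]
    have h2 : 0 < d / (64 * J) * ((S c).card + Y.card : ℝ) := by positivity
    linarith
  refine ⟨S c ∪ Y', hY'ne.mono Finset.subset_union_right, ?_, ?_⟩
  · rw [pairs_union_self G hdis', Finset.card_union_of_disjoint hdis', pairs_symm G (S c) Y']
    have h1 := pairs_nonneg G (S c) (S c)
    have h2 := pairs_nonneg G Y' Y'
    have h3 : (Y'.card : ℝ) ≤ Y.card := by exact_mod_cast Finset.card_le_card (Finset.filter_subset _ _)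
    have h4 : d / (64 * J) * ((S c).card + Y'.card : ℝ) ≤
        d / (64 * J) * ((S c).card + Y.card : ℝ) := by gcongr
    have h5 : (d : ℝ) / (32 * J) * ((S c).card + Y'.card : ℝ) =
        2 * (d / (64 * J) * ((S c).card + Y'.card : ℝ)) := by field_simp; norm_num
    push_cast
    linarith
  · intro v hv
    have hdJ : (d : ℝ) * 1 ≤ d * J := by gcongr
    rcases Finset.mem_union.1 hv with h | h
    · have h1 := hV0 v (Finset.mem_of_mem_filter v h)
      have h2 := row_mono G (S c ∪ Y') v
      linarith
    · rw [Finset.sum_union hdis']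
      rw [hY', Finset.mem_filter, hY, Finset.mem_filter] at h
      have h1 : ∑ u ∈ Y', adjI G v u ≤ ∑ u ∈ Y0, adjI G v u :=
        Finset.sum_le_sum_of_subset_of_nonneg
          ((Finset.filter_subset _ _).trans (Finset.filter_subset _ _))
          fun _ _ _ => adjI_nonneg G _ _
      have h2 := h.2
      have h3 := h.1.2
      rw [hT] at h2
      linarith

/-- Girão–Hunter dichotomy: an almost regular induced subgraph of large average degree, or a
very unbalanced partition carrying many edges. -/
theorem dichotomy :
    ∃ c₁ c₂ : ℝ, 0 < c₁ ∧ 0 < c₂ ∧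
      ∀ L d : ℕ, 16 ≤ L → 16 ≤ d →
      ∀ (V : Type) [Fintype V] [Nonempty V] (G : SimpleGraph V),
        (d : ℝ) ≤ avgDeg G → Degenerate G d →
        (∃ s : Set V, s.Nonempty ∧
            c₁ * (d : ℝ) / (Real.log L) ^ 2 ≤ avgDeg (G.induce s) ∧
            (maxDeg (G.induce s) : ℝ) ≤ c₂ * avgDeg (G.induce s) * (Real.log L) ^ 2) ∨
        (∃ A : Finset V,
            (L : ℝ) * ((Finset.univ \ A).card : ℝ) ≤ (A.card : ℝ) ∧
            (Fintype.card V : ℝ) * (d : ℝ) / 8 ≤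
              ((G.edgeFinset.filter fun e => ∃ a ∈ A, ∃ b ∉ A, e = s(a, b)).card : ℝ)) := by
  refine ⟨1 / 64, 300000, by norm_num, by norm_num, ?_⟩
  intro L d hL hd V _ _ G havg hdegen
  have hdeg : ∀ s : Finset V, pairs G s s ≤ 2 * d * s.card :=
    fun s => degen_pairs G d hdegen s.card s rfl
  obtain ⟨n, hn⟩ : ∃ n : ℝ, n = Fintype.card V := ⟨_, rfl⟩
  have hn0 : 0 < n := by rw [hn]; exact_mod_cast Fintype.card_pos
  have hd' : (16 : ℝ) ≤ d := by exact_mod_cast hd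
  have hL' : (16 : ℝ) ≤ L := by exact_mod_cast hL
  have hd0 : (0 : ℝ) < d := by linarith
  have htot : n * d ≤ pairs G Finset.univ Finset.univ := by
    rw [avgDeg_eq, ← hn, le_div_iff₀ hn0] at havg
    unfold pairs
    linarith
  have htot2 : pairs G Finset.univ Finset.univ ≤ 2 * d * n := by
    have := hdeg Finset.univ
    rwa [Finset.card_univ, ← hn] at this
  rw [← hn]
  -- logarithms
  obtain ⟨J, hJ⟩ : ∃ J, J = Nat.log 2 L := ⟨_, rfl⟩
  have hJ1 : 1 ≤ J := by
    rw [hJ]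
    exact Nat.log_pos (by norm_num) (by omega)
  have hJpow : 2 * ((L : ℝ) + 1) ≤ 16 * 2 ^ J := by
    have h1 : L < 2 ^ (J + 1) := by rw [hJ]; exact Nat.lt_pow_succ_log_self (by norm_num) L
    have h2 : (L : ℝ) < 2 ^ (J + 1) := by exact_mod_cast h1
    rw [pow_succ] at h2
    linarith
  have hlog2 := Real.log_two_gt_d9
  have hlogJ : (J : ℝ) ≤ 2 * Real.log L := by
    have h1 : 2 ^ J ≤ L := by rw [hJ]; exact Nat.pow_log_le_self 2 (by omega)
    have h2 : ((2 : ℝ) ^ J) ≤ L := by exact_mod_cast h1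
    have h3 := Real.log_le_log (by positivity) h2
    rw [Real.log_pow] at h3
    have h4 : (J : ℝ) * (1 / 2) ≤ J * Real.log 2 := by gcongr; linarith
    linarith
  have hlog1 : 1 ≤ Real.log L := by
    have h3 := Real.log_le_log (by norm_num) hL'
    have h4 : Real.log 16 = 4 * Real.log 2 := by
      rw [show (16 : ℝ) = 2 ^ 4 by norm_num, Real.log_pow]; norm_num
    linarith
  have hJ' : (1 : ℝ) ≤ J := by exact_mod_cast hJ1
  have hJ0 : (0 : ℝ) < J := by linarith
  -- reduction of (A)
  have hA : (∃ s : Finset V, s.Nonempty ∧ d / (32 * J) * s.card ≤ pairs G s s ∧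
      ∀ v ∈ s, ∑ u ∈ s, adjI G v u ≤ 2208 * d * J) →
      (∃ s : Set V, s.Nonempty ∧
            1 / 64 * (d : ℝ) / (Real.log L) ^ 2 ≤ avgDeg (G.induce s) ∧
            (maxDeg (G.induce s) : ℝ) ≤ 300000 * avgDeg (G.induce s) * (Real.log L) ^ 2) := by
    rintro ⟨s, hs, h1, h2⟩
    obtain ⟨t, ht⟩ : ∃ t : Set V, ∀ v, v ∈ s ↔ v ∈ t := ⟨{v | v ∈ s}, fun _ => Iff.rfl⟩
    obtain ⟨h3, h4⟩ := finish G s t ht hs _ _ h1 h2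
    refine ⟨t, ?_, ?_, ?_⟩
    · obtain ⟨x, hx⟩ := hs
      exact ⟨x, (ht x).1 hx⟩
    · refine le_trans ?_ h3
      rw [div_le_div_iff₀ (by positivity) (by positivity)]
      have h5 : (J : ℝ) ≤ 2 * (Real.log L) ^ 2 := by nlinarith
      calc 1 / 64 * (d : ℝ) * (32 * J) ≤ 1 / 64 * (d : ℝ) * (32 * (2 * (Real.log L) ^ 2)) := by gcongr
        _ = d * (Real.log L) ^ 2 := by ring
    · refine h4.trans ?_
      have h5 : (J : ℝ) ^ 2 ≤ 4 * (Real.log L) ^ 2 := by nlinarith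
      calc 2208 * (d : ℝ) * J = 70656 * (d / (32 * J)) * J ^ 2 := by field_simp; norm_num
        _ ≤ 70656 * (d / (32 * J)) * (4 * (Real.log L) ^ 2) := by gcongr
        _ = 282624 * (d / (32 * J)) * (Real.log L) ^ 2 := by ring
        _ ≤ 300000 * avgDeg (G.induce t) * (Real.log L) ^ 2 := by
          gcongr
          norm_num
  -- the vertex classes
  set r : V → ℝ := fun v => ∑ u, adjI G v u with hr
  have hr0 : ∀ v, 0 ≤ r v := fun v => Finset.sum_nonneg fun _ _ => adjI_nonneg G _ _
  have markov : ∀ (s : Finset V) (x : ℝ), (∀ v ∈ s, x ≤ r v) → (s.card : ℝ) * x ≤ 2 * d * n := by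
    intro s x hx
    refine le_trans ?_ htot2
    refine le_trans ?_ (pairs_mono G (Finset.subset_univ s) (Finset.Subset.refl _))
    rw [← nsmul_eq_mul]
    exact Finset.card_nsmul_le_sum _ _ _ hx
  set A : Finset V := Finset.univ.filter (fun v => r v ≤ 2 * d * (L + 1)) with hAdef
  set V0 : Finset V := Finset.univ.filter (fun v => r v ≤ 16 * d) with hV0
  set V1 : Finset V := Finset.univ \ V0 with hV1
  set M : Finset V := A \ V0 with hM
  have hV0A : V0 ⊆ A := by
    intro v hv
    simp only [hV0, hAdef, Finset.mem_filter, Finset.mem_univ, true_and] at hv ⊢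
    nlinarith
  by_cases hcut : n * d / 8 ≤ pairs G A (Finset.univ \ A)
  · right
    refine ⟨A, ?_, hcut.trans (cut_card G A)⟩
    have h1 := markov (Finset.univ \ A) (2 * d * (L + 1)) (by
      intro v hv
      simp only [hAdef, Finset.mem_sdiff, Finset.mem_filter, Finset.mem_univ, true_and, not_le] at hv
      exact hv.le)
    have h2 : ((Finset.univ \ A).card : ℝ) + A.card = n := by
      rw [hn, ← Finset.card_univ]
      exact_mod_cast Finset.card_sdiff_add_card_eq_card (Finset.subset_univ A)
    have h3 : ((Finset.univ \ A).card : ℝ) * (L + 1) * (2 * d) ≤ n * (2 * d) := by linarith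
    have h4 := le_of_mul_le_mul_right h3 (by linarith)
    linarith
  · left
    apply hA
    push Not at hcut
    have hV1p : pairs G V1 V1 ≤ n * d / 4 := by
      have h1 := markov V1 (16 * d) (by
        intro v hv
        simp only [hV1, hV0, Finset.mem_sdiff, Finset.mem_filter, Finset.mem_univ, true_and,
          not_le] at hv
        exact hv.le)
      have h2 := hdeg V1
      have h3 : (V1.card : ℝ) * 8 * (2 * d) ≤ n * (2 * d) := by linarith
      have h4 := le_of_mul_le_mul_right h3 (by linarith)
      have h5 : d * ((V1.card : ℝ) * 8) ≤ d * n := by gcongr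
      linarith
    have hsplit : pairs G Finset.univ Finset.univ =
        pairs G V0 V0 + pairs G V1 V1 + 2 * pairs G V0 V1 := by
      rw [← pairs_union_self G Finset.disjoint_sdiff]
      rw [Finset.union_sdiff_of_subset (Finset.subset_univ _)]
    have hsplit2 : pairs G V0 V1 ≤ pairs G V0 M + pairs G A (Finset.univ \ A) := by
      have h1 : V1 = M ∪ (Finset.univ \ A) := by
        ext v
        have := @hV0A v
        simp only [hV1, hM, Finset.mem_sdiff, Finset.mem_union, Finset.mem_univ, true_and]
        tauto
      have h2 : Disjoint M (Finset.univ \ A) := by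
        rw [Finset.disjoint_left]
        intro v hv hv'
        simp only [hM, Finset.mem_sdiff] at hv hv'
        exact hv'.2 hv.1
      rw [h1, pairs_union_right G _ h2]
      have h3 := pairs_mono G hV0A (Finset.Subset.refl (Finset.univ \ A))
      linarith
    by_cases hV0p : n * d / 4 ≤ pairs G V0 V0
    · refine ⟨V0, ?_, ?_, ?_⟩
      · rw [Finset.nonempty_iff_ne_empty]
        intro h
        rw [h] at hV0p
        have h1 : pairs G (∅ : Finset V) ∅ = 0 := by simp [pairs]
        have h2 : 0 < n * d / 4 := by positivity
        linarith
      · refine le_trans ?_ hV0p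
        have h2 : (V0.card : ℝ) ≤ n := by rw [hn]; exact_mod_cast Finset.card_le_univ V0
        calc d / (32 * J) * (V0.card : ℝ) ≤ d / 4 * n := by
              gcongr
              linarith
          _ = n * d / 4 := by ring
      · intro v hv
        rw [hV0, Finset.mem_filter] at hv
        have h1 := row_mono G V0 v
        have h2 : r v ≤ 16 * d := hv.2
        have hdJ : (d : ℝ) * 1 ≤ d * J := by gcongr
        simp only [hr] at h2
        linarith
    · push Not at hV0p
      have hMp : n * d / 8 ≤ pairs G M V0 := by
        rw [pairs_symm]
        linarith
      set Y : ℕ → Finset V := fun j =>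
        M.filter (fun v => 8 * 2 ^ j * d ≤ r v ∧ r v ≤ 16 * 2 ^ j * d) with hYdef
      have hcover : ∀ v ∈ M, ∃ j ∈ Finset.Icc 1 J, 8 * 2 ^ j * d ≤ r v ∧ r v ≤ 16 * 2 ^ j * d := by
        intro v hv
        simp only [hM, hAdef, hV0, Finset.mem_sdiff, Finset.mem_filter, Finset.mem_univ, true_and,
          not_le] at hv
        have hJok : r v ≤ 16 * 2 ^ J * d := by
          refine hv.1.trans ?_
          calc 2 * d * ((L : ℝ) + 1) = (2 * (L + 1)) * d := by ring
            _ ≤ 16 * 2 ^ J * d := by gcongr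
        have hex : ∃ j : ℕ, r v ≤ 16 * 2 ^ j * d := ⟨J, hJok⟩
        have hspec := Nat.find_spec hex
        have hle : Nat.find hex ≤ J := Nat.find_min' hex hJok
        have hpos : Nat.find hex ≠ 0 := by
          intro h0
          rw [h0] at hspec
          simp at hspec
          linarith [hv.2]
        obtain ⟨i, hi⟩ := Nat.exists_eq_succ_of_ne_zero hpos
        have hmin := Nat.find_min hex (show i < Nat.find hex by omega)
        push Not at hmin
        refine ⟨Nat.find hex, Finset.mem_Icc.2 ⟨by omega, hle⟩, ?_, hspec⟩
        rw [hi, Nat.succ_eq_add_one, pow_succ]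
        linarith
      have hsumY : pairs G M V0 ≤ ∑ j ∈ Finset.Icc 1 J, pairs G (Y j) V0 := by
        unfold pairs
        simp only [hYdef, Finset.sum_filter]
        rw [Finset.sum_comm (s := Finset.Icc 1 J)]
        refine Finset.sum_le_sum fun v hv => ?_
        obtain ⟨j, hj, hj2⟩ := hcover v hv
        have hnn : 0 ≤ ∑ u ∈ V0, adjI G v u := Finset.sum_nonneg fun _ _ => adjI_nonneg G _ _
        refine le_trans (le_of_eq ?_) (Finset.single_le_sum (a := j) (fun i _ => ?_) hj)
        · rw [if_pos hj2]
        · split_ifs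
          · exact hnn
          · exact le_refl _
      obtain ⟨j, -, hj⟩ : ∃ j ∈ Finset.Icc 1 J, n * d / (8 * J) ≤ pairs G (Y j) V0 := by
        apply Finset.exists_le_of_sum_le ⟨1, Finset.mem_Icc.2 ⟨le_refl _, hJ1⟩⟩
        refine le_trans (le_of_eq ?_) (hMp.trans hsumY)
        simp
        field_simp
      refine bucket G d J (2 ^ j) hJ1 (by positivity) hd hdeg V0 (Y j) ?_ ?_ ?_ ?_
      · refine Finset.disjoint_of_subset_right (Finset.filter_subset _ _) ?_
        exact Finset.disjoint_sdiff
      · intro v hv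
        rw [hV0, Finset.mem_filter] at hv
        exact hv.2
      · intro v hv
        simp only [hYdef, Finset.mem_filter] at hv
        push_cast
        exact hv.2
      · rw [← hn]; exact hj
end
end

section
/- For each integer k ≥ 2, there exists a finite bipartite graph H that has no (not necessarily induced) subgraph isomorphic to the 4-cycle C₄, has at most 8k² vertices, has maximum degree at most 2k, has average degree at least k, and is isomorphic to an induced subgraph of K_{8k²}^{(2k)}. -/
open SimpleGraph
open scoped Classical

noncomputable section

/-- `G` is bipartite: the vertices can be partitioned into two independent sets. -/
def Bip {V : Type} (G : SimpleGraph V) : Prop :=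
  ∃ A : Set V, ∀ ⦃a b : V⦄, G.Adj a b → (a ∈ A ↔ b ∉ A)

/-- `G` contains `H` as a (not necessarily induced) subgraph. -/
def ContainsSub {V W : Type} (H : SimpleGraph V) (G : SimpleGraph W) : Prop :=
  ∃ f : V → W, Function.Injective f ∧ ∀ ⦃a b : V⦄, H.Adj a b → G.Adj (f a) (f b)

/-- The 4-cycle. -/
def C4 : SimpleGraph (Fin 4) := SimpleGraph.fromRel fun i j => j = i + 1

/-- The bipartite graph `K_ℓ^{(r)}`: one side is `Fin ℓ`, the other side has one vertex for
each `r`-element subset `S` of `Fin ℓ`, joined exactly to the elements of `S`. -/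
def setGraph (ℓ r : ℕ) : SimpleGraph (Fin ℓ ⊕ {s : Finset (Fin ℓ) // s.card = r}) :=
  SimpleGraph.fromRel fun x y =>
    match x, y with
    | Sum.inl v, Sum.inr S => v ∈ S.1
    | _, _ => False

/-- Point-line incidence graph of (part of) the affine plane over `ZMod p`. -/
def planeGraph (p : ℕ) : SimpleGraph ((ZMod p × ZMod p) ⊕ (ZMod p × ZMod p)) :=
  SimpleGraph.fromRel fun x y =>
    match x, y with
    | Sum.inl q, Sum.inr l => q.2 = l.1 * q.1 + l.2
    | _, _ => False

lemma planeGraph_lr (p : ℕ) (q l : ZMod p × ZMod p) :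
    (planeGraph p).Adj (Sum.inl q) (Sum.inr l) ↔ q.2 = l.1 * q.1 + l.2 := by
  simp [planeGraph, SimpleGraph.fromRel_adj]

lemma planeGraph_rl (p : ℕ) (q l : ZMod p × ZMod p) :
    (planeGraph p).Adj (Sum.inr l) (Sum.inl q) ↔ q.2 = l.1 * q.1 + l.2 := by
  simp [planeGraph, SimpleGraph.fromRel_adj]

lemma planeGraph_ll (p : ℕ) (q l : ZMod p × ZMod p) :
    ¬ (planeGraph p).Adj (Sum.inl q) (Sum.inl l) := by
  simp [planeGraph, SimpleGraph.fromRel_adj]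

lemma planeGraph_rr (p : ℕ) (q l : ZMod p × ZMod p) :
    ¬ (planeGraph p).Adj (Sum.inr q) (Sum.inr l) := by
  simp [planeGraph, SimpleGraph.fromRel_adj]

lemma setGraph_lr (l r : ℕ) (v S) :
    (setGraph l r).Adj (Sum.inl v) (Sum.inr S) ↔ v ∈ S.1 := by
  simp [setGraph, SimpleGraph.fromRel_adj]

lemma setGraph_rl (l r : ℕ) (v S) :
    (setGraph l r).Adj (Sum.inr S) (Sum.inl v) ↔ v ∈ S.1 := by
  simp [setGraph, SimpleGraph.fromRel_adj]

lemma setGraph_ll (l r : ℕ) (v w) :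
    ¬ (setGraph l r).Adj (Sum.inl v) (Sum.inl w) := by
  simp [setGraph, SimpleGraph.fromRel_adj]

lemma setGraph_rr (l r : ℕ) (v w) :
    ¬ (setGraph l r).Adj (Sum.inr v) (Sum.inr w) := by
  simp [setGraph, SimpleGraph.fromRel_adj]

lemma planeGraph_degree (p : ℕ) [Fact p.Prime] (v) : (planeGraph p).degree v = p := by
  rw [← SimpleGraph.card_neighborFinset_eq_degree]
  rcases v with ⟨x, y⟩ | ⟨a, b⟩
  · have : (planeGraph p).neighborFinset (Sum.inl (x, y)) =
        Finset.univ.image (fun a : ZMod p => Sum.inr (a, y - a * x)) := by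
      ext w
      rcases w with w | ⟨c, d⟩
      · simp [planeGraph_ll]
      · simp [planeGraph_lr, sub_eq_iff_eq_add, add_comm]
    rw [this, Finset.card_image_of_injective _ (fun a b h => by simpa using (by simpa using h : _ ∧ _).1)]
    simp [ZMod.card]
  · have : (planeGraph p).neighborFinset (Sum.inr (a, b)) =
        Finset.univ.image (fun x : ZMod p => Sum.inl (x, a * x + b)) := by
      ext w
      rcases w with ⟨c, d⟩ | w
      · simp [planeGraph_rl, eq_comm]
      · simp [planeGraph_rr]
    rw [this, Finset.card_image_of_injective _ (fun a b h => by simpa using (by simpa using h : _ ∧ _).1)]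
    simp [ZMod.card]

lemma plane_key {p : ℕ} [Fact p.Prime] {q r l m : ZMod p × ZMod p}
    (h1 : q.2 = l.1 * q.1 + l.2) (h2 : q.2 = m.1 * q.1 + m.2)
    (h3 : r.2 = l.1 * r.1 + l.2) (h4 : r.2 = m.1 * r.1 + m.2) : q = r ∨ l = m := by
  have : (l.1 - m.1) * (q.1 - r.1) = 0 := by linear_combination h2 - h1 - h4 + h3
  rcases mul_eq_zero.1 this with h | h
  · right
    refine Prod.ext (sub_eq_zero.1 h) ?_
    linear_combination h2 - h1 - q.1 * h
  · left
    refine Prod.ext (sub_eq_zero.1 h) ?_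
    linear_combination h1 - h3 + l.1 * h

lemma planeGraph_C4 (p : ℕ) [Fact p.Prime] : ¬ ContainsSub C4 (planeGraph p) := by
  rintro ⟨f, hf, h⟩
  have h01 := @h 0 1 (by simp [C4])
  have h12 := @h 1 2 (by simp [C4])
  have h23 := @h 2 3 (by simp [C4])
  have h30 := @h 3 0 (by simp [C4])
  have n02 : f 0 ≠ f 2 := fun e => absurd (hf e) (by decide)
  have n13 : f 1 ≠ f 3 := fun e => absurd (hf e) (by decide)
  generalize f 0 = a at *
  generalize f 1 = b at *
  generalize f 2 = c at *
  generalize f 3 = d at *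
  rcases a with a | a <;> rcases b with b | b <;>
    first | exact planeGraph_ll _ _ _ h01 | exact planeGraph_rr _ _ _ h01 | skip
  all_goals
    rcases c with c | c <;>
    first | exact planeGraph_ll _ _ _ h12 | exact planeGraph_rr _ _ _ h12 | skip
  all_goals
    rcases d with d | d <;>
    first | exact planeGraph_ll _ _ _ h23 | exact planeGraph_rr _ _ _ h23 | skip
  all_goals
    simp only [planeGraph_lr, planeGraph_rl] at h01 h12 h23 h30
  · rcases plane_key h01 h30 h12 h23 with e | e
    · exact n02 (by rw [e])
    · exact n13 (by rw [e])
  · rcases plane_key h01 h12 h30 h23 with e | e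
    · exact n13 (by rw [e])
    · exact n02 (by rw [e])

lemma plane_embed (k p : ℕ) [Fact p.Prime] (hp : p ≤ 2 * k) :
    Nonempty (planeGraph p ↪g setGraph (8 * k ^ 2) (2 * k)) := by
  have hp2 := (Fact.out : p.Prime).two_le
  have hpp : p * p ≤ 4 * k ^ 2 := by nlinarith
  obtain ⟨g⟩ : Nonempty ((ZMod p × ZMod p) ↪ Fin (8 * k ^ 2)) := by
    apply Function.Embedding.nonempty_of_card_le
    simp only [Fintype.card_prod, ZMod.card, Fintype.card_fin]
    omega
  obtain ⟨T, hT, hTc⟩ : ∃ T ⊆ (Finset.univ.map g)ᶜ, T.card = 2 * k - p := by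
    apply Finset.exists_subset_card_eq
    rw [Finset.card_compl, Finset.card_map, Finset.card_univ]
    simp only [Fintype.card_prod, ZMod.card, Fintype.card_fin]
    have : k ≤ k ^ 2 := Nat.le_self_pow (by norm_num) k
    omega
  have hT' : ∀ q, g q ∉ T := fun q hq => by
    have := hT hq
    simp at this
  let P : ZMod p × ZMod p → Finset (ZMod p × ZMod p) := fun l =>
    Finset.univ.image (fun x : ZMod p => (x, l.1 * x + l.2))
  have hPm : ∀ l q, q ∈ P l ↔ q.2 = l.1 * q.1 + l.2 := by
    rintro l ⟨x, y⟩
    simp [P, eq_comm]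
  have hPc : ∀ l, (P l).card = p := fun l => by
    rw [Finset.card_image_of_injective _ (fun a b h => by simpa using (by simpa using h : _ ∧ _).1)]
    simp [ZMod.card]
  let S : ZMod p × ZMod p → Finset (Fin (8 * k ^ 2)) := fun l => (P l).map g ∪ T
  have hSm : ∀ l q, g q ∈ S l ↔ q.2 = l.1 * q.1 + l.2 := by
    intro l q
    rw [← hPm]
    simp only [S, Finset.mem_union, hT', or_false, Finset.mem_map' g]
  have hSc : ∀ l, (S l).card = 2 * k := fun l => by
    rw [Finset.card_union_of_disjoint, Finset.card_map, hPc, hTc]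
    · omega
    · rw [Finset.disjoint_left]
      intro a ha
      obtain ⟨q, -, rfl⟩ := Finset.mem_map.1 ha
      exact hT' q
  have hSi : ∀ l m, S l = S m → l = m := by
    intro l m h
    have h0 : l.1 * 0 + l.2 = m.1 * 0 + m.2 :=
      (hSm m (0, l.1 * 0 + l.2)).1 (h ▸ (hSm l _).2 rfl)
    have h1 : l.1 * 1 + l.2 = m.1 * 1 + m.2 :=
      (hSm m (1, l.1 * 1 + l.2)).1 (h ▸ (hSm l _).2 rfl)
    refine Prod.ext ?_ ?_
    · linear_combination h1 - h0
    · linear_combination h0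
  refine ⟨⟨⟨Sum.map g (fun l => ⟨S l, hSc l⟩), ?_⟩, ?_⟩⟩
  · apply Function.Injective.sumMap g.injective
    intro l m h
    exact hSi l m (congrArg Subtype.val h)
  · rintro (a | a) (b | b)
    · simp [planeGraph_ll, setGraph_ll]
    · simp [planeGraph_lr, setGraph_lr, hSm]
    · simp [planeGraph_rl, setGraph_rl, hSm]
    · simp [planeGraph_rr, setGraph_rr]

/-- Girão–Hunter: a small `C₄`-free bipartite graph of average degree at least `k` living
inside `K_{8k²}^{(2k)}` as an induced subgraph. -/
theorem exists_good_H (k : ℕ) (hk : 2 ≤ k) :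
    ∃ (m : ℕ) (H : SimpleGraph (Fin m)),
      0 < m ∧ m ≤ 8 * k ^ 2 ∧ Bip H ∧ ¬ ContainsSub C4 H ∧
      maxDeg H ≤ 2 * k ∧ (k : ℝ) ≤ avgDeg H ∧
      ∃ s : Set (Fin (8 * k ^ 2) ⊕ {t : Finset (Fin (8 * k ^ 2)) // t.card = 2 * k}),
        Nonempty (H ≃g (setGraph (8 * k ^ 2) (2 * k)).induce s) := by
  obtain ⟨p, hp, hkp, hp2⟩ := Nat.exists_prime_lt_and_le_two_mul k (by omega)
  haveI : Fact p.Prime := ⟨hp⟩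
  have hpos := hp.pos
  obtain ⟨F⟩ := plane_embed k p hp2
  have hc : Fintype.card ((ZMod p × ZMod p) ⊕ (ZMod p × ZMod p)) = 2 * (p * p) := by
    simp [ZMod.card]; ring
  let e : Fin (2 * (p * p)) ≃ ((ZMod p × ZMod p) ⊕ (ZMod p × ZMod p)) :=
    (Fintype.equivFinOfCardEq hc).symm
  let H := (planeGraph p).comap e
  let i : H ≃g planeGraph p := SimpleGraph.Iso.comap e _
  have hd : ∀ v [Fintype (H.neighborSet v)], H.degree v = p := fun v _ =>
    (SimpleGraph.Iso.degree_eq i v).symm.trans (planeGraph_degree p (i v))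
  refine ⟨2 * (p * p), H, by positivity, by nlinarith, ?_, ?_, ?_, ?_, ?_⟩
  · refine ⟨{v | (e v).isLeft}, fun a b h => ?_⟩
    have h' : (planeGraph p).Adj (e a) (e b) := h
    simp only [Set.mem_setOf_eq]
    generalize e a = x at *
    generalize e b = y at *
    rcases x with x | x <;> rcases y with y | y
    · exact absurd h' (planeGraph_ll _ _ _)
    · simp
    · simp
    · exact absurd h' (planeGraph_rr _ _ _)
  · rintro ⟨f, hf, h⟩
    exact planeGraph_C4 p ⟨fun x => e (f x), e.injective.comp hf, fun a b hab => h hab⟩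
  · exact SimpleGraph.maxDegree_le_of_forall_degree_le _ _ (fun v => (hd v).le.trans hp2)
  · have hp0 : (0 : ℝ) < p := by exact_mod_cast hpos
    have : avgDeg H = p := by
      unfold avgDeg
      simp only [hd]
      simp
      field_simp
    rw [this]
    exact_mod_cast hkp.le
  · let E : H ↪g setGraph (8 * k ^ 2) (2 * k) := F.comp i.toEmbedding
    refine ⟨Set.range E, ⟨⟨Equiv.ofInjective E E.injective, ?_⟩⟩⟩
    intro a b
    exact E.map_rel_iff
end
end

section
/- Let D ≥ 2, t ≥ 2, and h be integers. Then there exist δ > 0 and a natural number n₀ such that the following holds for all n ≥ n₀. Let S be a collection of subsets of {1, 2, …, n} with |F| < δ·n for every F ∈ S. If S does not t-shatter any h-element subset of {1, 2, …, n}, then there exists a subset I ⊆ {1, 2, …, n} of size D such that |I ∩ F| < t for every F ∈ S. -/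
open scoped Classical

noncomputable section

theorem hyper_ramsey (t : ℕ) : ∀ a b : ℕ, ∃ N : ℕ, ∀ (α : Type) (X : Finset α) (c : Finset α → Prop),
    N ≤ X.card →
    (∃ A ⊆ X, A.card = a ∧ ∀ T ⊆ A, T.card = t → c T) ∨
    (∃ B ⊆ X, B.card = b ∧ ∀ T ⊆ B, T.card = t → ¬ c T) := by
  induction t with
  | zero =>
    intro a b
    refine ⟨max a b, fun α X c hX => ?_⟩
    by_cases hc : c ∅
    · left
      obtain ⟨A, hA, hAc⟩ := Finset.exists_subset_card_eq (le_trans (le_max_left a b) hX)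
      refine ⟨A, hA, hAc, fun T _ h => ?_⟩
      rw [Finset.card_eq_zero.1 h]; exact hc
    · right
      obtain ⟨A, hA, hAc⟩ := Finset.exists_subset_card_eq (le_trans (le_max_right a b) hX)
      refine ⟨A, hA, hAc, fun T _ h => ?_⟩
      rw [Finset.card_eq_zero.1 h]; exact hc
  | succ t ih =>
    intro a
    induction a with
    | zero =>
      intro b
      refine ⟨0, fun α X c _ => Or.inl ⟨∅, by simp, by simp, fun T hT h => ?_⟩⟩
      rw [Finset.subset_empty.1 hT] at h; simp at h
    | succ a iha =>
      intro b
      induction b with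
      | zero =>
        refine ⟨0, fun α X c _ => Or.inr ⟨∅, by simp, by simp, fun T hT h => ?_⟩⟩
        rw [Finset.subset_empty.1 hT] at h; simp at h
      | succ b ihb =>
        obtain ⟨N1, h1⟩ := iha (b + 1)
        obtain ⟨N2, h2⟩ := ihb
        obtain ⟨N, hN⟩ := ih N1 N2
        refine ⟨N + 1, fun α X c hX => ?_⟩
        obtain ⟨x, hx⟩ : X.Nonempty := Finset.card_pos.1 (by omega)
        have key : ∀ (d : Finset α → Prop) (Y A : Finset α) (m : ℕ), A ⊆ Y → Y ⊆ X.erase x →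
            A.card = m →
            (∀ T ⊆ Y, T.card = t → d (insert x T)) → (∀ T ⊆ A, T.card = t + 1 → d T) →
            ∃ A' ⊆ X, A'.card = m + 1 ∧ ∀ T ⊆ A', T.card = t + 1 → d T := by
          intro d Y A m hAY hY hA hd1 hd2
          have hxA : x ∉ A := fun h => by simpa using hY (hAY h)
          refine ⟨insert x A, ?_, by rw [Finset.card_insert_of_notMem hxA, hA], ?_⟩
          · exact Finset.insert_subset hx ((hAY.trans hY).trans (Finset.erase_subset _ _))
          · intro T hT hTc
            by_cases hxT : x ∈ T
            · have := hd1 (T.erase x) ((Finset.subset_insert_iff.1 hT).trans hAY)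
                (by rw [Finset.card_erase_of_mem hxT]; omega)
              rwa [Finset.insert_erase hxT] at this
            · exact hd2 T ((Finset.subset_insert_iff_of_notMem hxT).1 hT) hTc
        rcases hN α (X.erase x) (fun T => c (insert x T))
          (by rw [Finset.card_erase_of_mem hx]; omega) with ⟨Y, hY, hYc, hd⟩ | ⟨Y, hY, hYc, hd⟩
        · have hYX := hY.trans (Finset.erase_subset _ _)
          rcases h1 α Y c hYc.ge with ⟨A, hA, hAc, hAd⟩ | ⟨A, hA, hAc, hAd⟩
          · exact Or.inl (key c Y A a hA hY hAc hd hAd)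
          · exact Or.inr ⟨A, hA.trans hYX, hAc, hAd⟩
        · have hYX := hY.trans (Finset.erase_subset _ _)
          rcases h2 α Y c hYc.ge with ⟨A, hA, hAc, hAd⟩ | ⟨A, hA, hAc, hAd⟩
          · exact Or.inl ⟨A, hA.trans hYX, hAc, hAd⟩
          · exact Or.inr (key (fun T => ¬ c T) Y A b hA hY hAc hd hAd)

theorem free_fun (N n K : ℕ) (G : Finset (Fin n) → Finset (Fin n))
    (hG : ∀ T, T.card ≤ N → (G T).card ≤ K) (hK : 2 ^ N * N * K < n) :
    ∃ f : Fin N → Fin n, ∀ (J : Finset (Fin N)) (j : Fin N), j ∉ J → f j ∉ G (J.image f) := by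
  by_contra hcon
  push Not at hcon
  let B : Finset (Fin N) × Fin N → Finset (Fin N → Fin n) := fun p =>
    Finset.univ.filter fun f => p.2 ∉ p.1 ∧ f p.2 ∈ G (p.1.image f)
  have hB : ∀ p, (B p).card ≤ K * n ^ (N - 1) := by
    rintro ⟨J, j⟩
    let r : (Fin N → Fin n) → ({i : Fin N // i ≠ j} → Fin n) := fun f i => f i
    have h1 := Finset.card_le_mul_card_image (s := B (J, j)) (f := r) K (by
      intro g hg
      obtain ⟨f0, hf0, rfl⟩ := Finset.mem_image.1 hg
      have hj : j ∉ J := (Finset.mem_filter.1 hf0).2.1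
      refine le_trans ?_ (hG (J.image f0) (Finset.card_image_le.trans ?_))
      · refine Finset.card_le_card_of_injOn (fun f => f j) ?_ ?_
        · intro f hf
          have hf := Finset.mem_filter.1 hf
          have h2 := (Finset.mem_filter.1 hf.1).2.2
          have : J.image f = J.image f0 := Finset.image_congr (fun i hi =>
            congrFun hf.2 ⟨i, fun h => hj (h ▸ hi)⟩)
          rw [← this]; exact h2
        · intro f hf f' hf' hff
          have hf := (Finset.mem_filter.1 hf).2
          have hf' := (Finset.mem_filter.1 hf').2
          funext i
          by_cases hi : i = j
          · subst hi; exact hff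
          · exact congrFun (hf.trans hf'.symm) ⟨i, hi⟩
      · simpa using J.card_le_univ)
    refine h1.trans (Nat.mul_le_mul_left _ ((Finset.card_le_univ _).trans ?_))
    simp
  have hcov : (Finset.univ : Finset (Fin N → Fin n)) ⊆ Finset.univ.biUnion B := by
    intro f _
    obtain ⟨J, j, h1, h2⟩ := hcon f
    exact Finset.mem_biUnion.2 ⟨(J, j), Finset.mem_univ _, by simp [B, h1]; simpa using h2⟩
  have h3 := (Finset.card_le_card hcov).trans
    (Finset.card_biUnion_le_card_mul _ _ _ (fun p _ => hB p))
  simp at h3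
  rcases Nat.eq_zero_or_pos N with rfl | hN
  · simp at h3
  · have hn : 0 < n := by omega
    have : n ^ N = n * n ^ (N - 1) := by
      rw [← pow_succ']; congr 1; omega
    rw [this, ← mul_assoc] at h3
    exact absurd (Nat.le_of_mul_le_mul_right h3 (by positivity)) (by omega)

/-- Girão–Hunter shattering lemma. -/
theorem shattering_lemma (D t h : ℕ) (hD : 2 ≤ D) (ht : 2 ≤ t) :
    ∃ (δ : ℝ) (n₀ : ℕ), 0 < δ ∧
      ∀ n : ℕ, n₀ ≤ n →
      ∀ S : Set (Finset (Fin n)),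
        (∀ F ∈ S, (F.card : ℝ) < δ * n) →
        (¬ ∃ R : Finset (Fin n), R.card = h ∧
            ∀ T ⊆ R, T.card = t → ∃ F ∈ S, F ∩ R = T) →
        ∃ I : Finset (Fin n), I.card = D ∧ ∀ F ∈ S, (I ∩ F).card < t := by
  obtain ⟨N, hN⟩ := hyper_ramsey t h D
  obtain ⟨C, hC⟩ : ∃ C, C = 2 ^ N * N := ⟨_, rfl⟩
  refine ⟨1 / (2 * (C + 1)), 2 * C * N + 1, by positivity, ?_⟩
  intro n hn S hS hsh
  let G0 : Finset (Fin n) → Finset (Fin n) := fun T =>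
    if hT : ∃ F ∈ S, T ⊆ F then hT.choose else ∅
  have hG0 : ∀ T, (∃ F ∈ S, T ⊆ F) → G0 T ∈ S ∧ T ⊆ G0 T := by
    intro T hT
    simp only [G0, dif_pos hT]
    exact hT.choose_spec
  have hG0c : ∀ T, (G0 T).card ≤ n / (2 * (C + 1)) := by
    intro T
    by_cases hT : ∃ F ∈ S, T ⊆ F
    · have := hS _ (hG0 T hT).1
      rw [Nat.le_div_iff_mul_le (by positivity)]
      rw [one_div, inv_mul_eq_div, lt_div_iff₀ (by positivity)] at this
      exact_mod_cast this.le
    · simp [G0, dif_neg hT]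
  obtain ⟨f, hf⟩ := free_fun N n (n / (2 * (C + 1)) + N) (fun T => G0 T ∪ T)
    (fun T hT => (Finset.card_union_le _ _).trans (add_le_add (hG0c T) hT)) (by
      rw [← hC]
      have := Nat.div_mul_le_self n (2 * (C + 1))
      nlinarith)
  have hinj : Function.Injective f := by
    intro i j hij
    by_contra hne
    have := hf {i} j (by simpa using fun h => hne h.symm)
    simp [hij] at this
  have hfree : ∀ T ⊆ Finset.univ.image f, ∀ x ∈ Finset.univ.image f, x ∈ G0 T → x ∈ T := by
    intro T hT x hx hxG
    obtain ⟨j, _, rfl⟩ := Finset.mem_image.1 hx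
    obtain ⟨J, _, rfl⟩ := Finset.subset_image_iff.1 hT
    by_contra hc
    exact hf J j (fun hj => hc (Finset.mem_image_of_mem _ hj)) (Finset.mem_union_left _ hxG)
  rcases hN (Fin n) (Finset.univ.image f) (fun T => ∃ F ∈ S, T ⊆ F)
    (by rw [Finset.card_image_of_injective _ hinj]; simp) with ⟨R, hR, hRc, hg⟩ | ⟨I, hI, hIc, hg⟩
  · refine absurd ⟨R, hRc, fun T hT hTc => ?_⟩ hsh
    obtain ⟨h1, h2⟩ := hG0 T (hg T hT hTc)
    refine ⟨G0 T, h1, Finset.Subset.antisymm ?_ (Finset.subset_inter h2 hT)⟩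
    intro x hx
    rw [Finset.mem_inter] at hx
    exact hfree T (hT.trans hR) x (hR hx.2) hx.1
  · refine ⟨I, hIc, fun F hF => ?_⟩
    by_contra hlt
    obtain ⟨T, hT, hTc⟩ := Finset.exists_subset_card_eq (not_lt.1 hlt)
    exact hg T (hT.trans Finset.inter_subset_left) hTc ⟨F, hF, hT.trans Finset.inter_subset_right⟩
end
end

section
/- Let k and d be positive integers, and let B be a finite nonempty indexed family of closed balls of positive radius in d-dimensional Euclidean space ℝ^d that is k-thin, meaning every point of ℝ^d lies in at most k of the balls. Then the intersection graph of B — the simple graph whose vertices are the indices of B, with two distinct indices adjacent exactly when the corresponding balls have nonempty intersection — has a vertex of degree strictly less than k · 3^d. -/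
open scoped Classical

noncomputable section

/-- The intersection graph of an indexed family of sets. -/
def interGraph {ι α : Type} (B : ι → Set α) : SimpleGraph ι :=
  SimpleGraph.fromRel fun i j => (B i ∩ B j).Nonempty

/-- In a `k`-thin family of closed balls in `ℝ^d`, some ball intersects fewer than
`k · 3^d` of the other balls. -/
theorem kthin_balls_min_degree (k d : ℕ) (hk : 0 < k) (hd : 0 < d)
    (ι : Type) [Fintype ι] [Nonempty ι]
    (c : ι → EuclideanSpace ℝ (Fin d)) (r : ι → ℝ) (hr : ∀ i, 0 < r i)
    (hthin : ∀ x : EuclideanSpace ℝ (Fin d),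
      {i : ι | x ∈ Metric.closedBall (c i) (r i)}.ncard ≤ k) :
    ∃ i : ι,
      ((interGraph fun i => Metric.closedBall (c i) (r i)).neighborSet i).ncard
        < k * 3 ^ d := by
  obtain ⟨i, hi⟩ := Finite.exists_min r
  refine ⟨i, ?_⟩
  set G := interGraph fun i => Metric.closedBall (c i) (r i) with hG
  set N : Finset ι := Finset.univ.filter (fun j => j = i ∨ G.Adj i j) with hN
  have hsub : ∀ j, ∃ y, j ∈ N → dist (c j) y ≤ r j - r i ∧ dist y (c i) ≤ 2 * r i := by
    intro j
    by_cases hj : j ∈ N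
    · have hd' : dist (c j) (c i) ≤ 2 * r i + (r j - r i) := by
        have h0 := hr i
        have h1 := hi j
        rcases (Finset.mem_filter.1 hj).2 with h | h
        · subst h; simp; linarith
        · have h2 : (Metric.closedBall (c i) (r i) ∩ Metric.closedBall (c j) (r j)).Nonempty := by
            rcases ((SimpleGraph.fromRel_adj _ _ _).1 h).2 with h | h
            · exact h
            · rw [Set.inter_comm]; exact h
          obtain ⟨x, hx1, hx2⟩ := h2
          rw [Metric.mem_closedBall] at hx1 hx2
          have := dist_triangle_left (c j) (c i) x
          linarith
      obtain ⟨y, hy⟩ := exists_dist_le_le (sub_nonneg.2 (hi j)) (by linarith [hr i]) hd'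
      exact ⟨y, fun _ => hy⟩
    · exact ⟨0, fun h => absurd h hj⟩
  choose y hy using hsub
  have hcard : N.card = (G.neighborSet i).ncard + 1 := by
    have : (N : Set ι) = insert i (G.neighborSet i) := by
      ext j; simp [hN]
    rw [← Set.ncard_coe_finset, this, Set.ncard_insert_of_notMem (by simp) (Set.toFinite _)]
  have hpt : ∀ x, ∑ j ∈ N, (Metric.closedBall (y j) (r i)).indicator (fun _ => (1 : ENNReal)) x
      ≤ (Metric.closedBall (c i) (3 * r i)).indicator (fun _ => (k : ENNReal)) x := by
    intro x
    by_cases hx : x ∈ Metric.closedBall (c i) (3 * r i)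
    · rw [Set.indicator_of_mem hx]
      simp only [Set.indicator_apply]
      rw [Finset.sum_boole]
      have h1 : (N.filter (fun j => x ∈ Metric.closedBall (y j) (r i))).card ≤ k := by
        refine le_trans ?_ (hthin x)
        rw [← Set.ncard_coe_finset]
        refine Set.ncard_le_ncard ?_ (Set.toFinite _)
        intro j hj
        have hj' := Finset.mem_filter.1 (Finset.mem_coe.1 hj)
        have h2 := hy j hj'.1
        have h3 := Metric.mem_closedBall.1 hj'.2
        have h4 := dist_triangle x (y j) (c j)
        rw [dist_comm (y j) (c j)] at h4
        exact Metric.mem_closedBall.2 (by linarith [h2.1])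
      exact_mod_cast h1
    · rw [Finset.sum_eq_zero]
      · exact zero_le
      · intro j hj
        refine Set.indicator_of_notMem ?_ _
        intro h
        apply hx
        have h3 := Metric.mem_closedBall.1 h
        have h4 := dist_triangle x (y j) (c i)
        exact Metric.mem_closedBall.2 (by linarith [(hy j hj).2])
  have hint := MeasureTheory.lintegral_mono (μ := MeasureTheory.volume) hpt
  rw [MeasureTheory.lintegral_finsetSum _ (fun j _ => measurable_const.indicator Metric.isClosed_closedBall.measurableSet)] at hint
  simp only [MeasureTheory.lintegral_indicator Metric.isClosed_closedBall.measurableSet,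
    MeasureTheory.setLIntegral_const, one_mul] at hint
  have h3 : (MeasureTheory.volume (Metric.closedBall (c i) (3 * r i))) =
     3 ^ d * MeasureTheory.volume (Metric.closedBall (c i) (r i)) := by
    rw [MeasureTheory.Measure.addHaar_closedBall_mul _ _ (by norm_num) (hr i).le,
      MeasureTheory.Measure.addHaar_closedBall_center _ (c i)]
    simp [ENNReal.ofReal_pow]
  rw [h3, MeasureTheory.Measure.addHaar_closedBall_center _ (c i)] at hint
  simp only [MeasureTheory.Measure.addHaar_closedBall_center _ (y _)] at hint
  rw [Finset.sum_const, nsmul_eq_mul, ← mul_assoc] at hint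
  have hpos : MeasureTheory.volume (Metric.closedBall (0 : EuclideanSpace ℝ (Fin d)) (r i)) ≠ 0 :=
    (Metric.measure_closedBall_pos _ _ (hr i)).ne'
  have hfin : MeasureTheory.volume (Metric.closedBall (0 : EuclideanSpace ℝ (Fin d)) (r i)) ≠ ⊤ :=
    MeasureTheory.measure_closedBall_lt_top.ne
  have h5 := (ENNReal.mul_le_mul_iff_left hpos hfin).1 hint
  have h6 : N.card ≤ k * 3 ^ d := by exact_mod_cast h5
  omega
end
end
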